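/- arXiv:math/0512289 — 6 statements merged into one kernel-verified Lean document; each statement's English description precedes it below -/
import Mathlib

section
/- Theorem 2, implication (iv) ⇒ (i): If the germ-map is conditionally positive definite with respect to i, then its dissipation form is positive definite. -/
open scoped ComplexConjugate InnerProductSpace ComplexOrder

noncomputable section

/-- A pairing form of type `(V, W)`: conjugate-linear in the first argument and
linear in the second, with values in `ℂ`. -/
abbrev Pairing (V W : Type*) [AddCommGroup V] [Module ℂ V] [AddCommGroup W] [Module ℂ W] :=
  V →ₛₗ[starRingEnd ℂ] W →ₗ[ℂ] ℂ

/-- Theorem 2, (iv) ⇒ (i): if the germ-map `(λ, λ•, λ_•, λ••)` is conditionally positive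
definite with respect to the unital `*`-representation `i`, then its dissipation form is
positive definite. -/
theorem germ_cond_pos_def_implies_dissipation_pos_def
    {B : Type*} [Monoid B] [StarMul B]
    {D Db : Type*} [NormedAddCommGroup D] [InnerProductSpace ℂ D]
    [NormedAddCommGroup Db] [InnerProductSpace ℂ Db]
    (i : B → D →ₗ[ℂ] D)
    (hi1 : i 1 = LinearMap.id)
    (himul : ∀ x y : B, i (x * y) = (i x).comp (i y))
    (histar : ∀ (x : B) (η ζ : D), ⟪i (star x) η, ζ⟫_ℂ = ⟪η, i x ζ⟫_ℂ)
    (lam : B → Pairing D D) (lamU : B → Pairing Db D)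
    (lamL : B → Pairing D Db) (lamB : B → Pairing Db Db)
    (hlam : ∀ (x : B) (η ζ : D), lam (star x) η ζ = conj (lam x ζ η))
    (hlamU : ∀ (x : B) (ηb : Db) (ζ : D), lamU (star x) ηb ζ = conj (lamL x ζ ηb))
    (hlamB : ∀ (x : B) (ηb ζb : Db), lamB (star x) ηb ζb = conj (lamB x ζb ηb))
    (hCPD : ∀ (n : ℕ) (x : Fin n → B) (η : Fin n → D × Db),
      (∑ k, ∑ l, ⟪(η l).1, i (star (x l) * x k) (η k).1⟫_ℂ) = 0 →
      0 ≤ ∑ k, ∑ l,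
        (lam (star (x l) * x k) (η l).1 (η k).1
          + lamL (star (x l) * x k) (η l).1 (η k).2
          + lamU (star (x l) * x k) (η l).2 (η k).1
          + lamB (star (x l) * x k) (η l).2 (η k).2)) :
    ∀ (n : ℕ) (x : Fin n → B) (η : Fin n → D × Db),
      0 ≤ ∑ k, ∑ l,
        (lamB (star (x l) * x k) (η l).2 (η k).2
          + lamL (star (x l) * x k) (η l).1 (η k).2
          - lamL (x k) (i (x l) (η l).1) (η k).2
          + lamU (star (x l) * x k) (η l).2 (η k).1
          - lamU (star (x l)) (η l).2 (i (x k) (η k).1)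
          + lam (star (x l) * x k) (η l).1 (η k).1
          - lam (x k) (i (x l) (η l).1) (η k).1
          - lam (star (x l)) (η l).1 (i (x k) (η k).1)
          + lam 1 (i (x l) (η l).1) (i (x k) (η k).1)) := by
  intro n x η
  set S : D := ∑ k, i (x k) (η k).1 with hS
  have hzero : (∑ k, ∑ l, ⟪((Fin.cons (-S, 0) η : Fin (n + 1) → D × Db) l).1,
      i (star ((Fin.cons 1 x : Fin (n + 1) → B) l) * (Fin.cons 1 x : Fin (n + 1) → B) k)
        ((Fin.cons (-S, 0) η : Fin (n + 1) → D × Db) k).1⟫_ℂ) = 0 := by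
    have hinner (a b : B) (u v : D) : ⟪u, i (star a * b) v⟫_ℂ = ⟪i a u, i b v⟫_ℂ := by
      rw [himul, LinearMap.comp_apply, ← histar, star_star]
    simp_rw [hinner, ← sum_inner, ← inner_sum]
    simp [Fin.sum_univ_succ, hi1, ← hS]
  convert hCPD (n + 1) (Fin.cons 1 x) (Fin.cons (-S, 0) η) hzero using 1
  have hright (f : D →ₗ[ℂ] ℂ) : f S = ∑ k, f (i (x k) (η k).1) := map_sum f _ _
  have hleft (q : Pairing D D) (v : D) : q S v = ∑ l, q (i (x l) (η l).1) v :=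
    LinearMap.map_sum₂ q _ _ v
  have hleftb (q : Pairing D Db) (v : Db) : q S v = ∑ l, q (i (x l) (η l).1) v :=
    LinearMap.map_sum₂ q _ _ v
  simp only [Fin.sum_univ_succ, Fin.cons_zero, Fin.cons_succ, star_one, one_mul, mul_one,
    map_neg, map_zero, LinearMap.neg_apply, LinearMap.zero_apply, zero_add,
    Finset.sum_const_zero, Finset.sum_add_distrib, Finset.sum_sub_distrib, Finset.sum_neg_distrib,
    hright, hleft, hleftb]
  rw [Finset.sum_comm (f := fun l k => lam (star (x l)) (η l).1 (i (x k) (η k).1)),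
    Finset.sum_comm (f := fun l k => lamU (star (x l)) (η l).2 (i (x k) (η k).1)),
    Finset.sum_comm (f := fun l k => lam 1 (i (x l) (η l).1) (i (x k) (η k).1))]
  ring

end
end

section
/- Theorem 2, implication (i) ⇒ (iv): If the dissipation form of the germ-map is positive definite, then the germ-map is conditionally positive definite with respect to i. -/
open scoped ComplexConjugate InnerProductSpace ComplexOrder

noncomputable section

/-- Theorem 2, (i) ⇒ (iv): if the dissipation form of the germ-map `(λ, λ•, λ_•, λ••)` is
positive definite, then the germ-map is conditionally positive definite with respect to the
unital `*`-representation `i`. -/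
theorem dissipation_pos_def_implies_germ_cond_pos_def
    {B : Type*} [Monoid B] [StarMul B]
    {D Db : Type*} [NormedAddCommGroup D] [InnerProductSpace ℂ D]
    [NormedAddCommGroup Db] [InnerProductSpace ℂ Db]
    (i : B → D →ₗ[ℂ] D)
    (hi1 : i 1 = LinearMap.id)
    (himul : ∀ x y : B, i (x * y) = (i x).comp (i y))
    (histar : ∀ (x : B) (η ζ : D), ⟪i (star x) η, ζ⟫_ℂ = ⟪η, i x ζ⟫_ℂ)
    (lam : B → Pairing D D) (lamU : B → Pairing Db D)
    (lamL : B → Pairing D Db) (lamB : B → Pairing Db Db)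
    (hlam : ∀ (x : B) (η ζ : D), lam (star x) η ζ = conj (lam x ζ η))
    (hlamU : ∀ (x : B) (ηb : Db) (ζ : D), lamU (star x) ηb ζ = conj (lamL x ζ ηb))
    (hlamB : ∀ (x : B) (ηb ζb : Db), lamB (star x) ηb ζb = conj (lamB x ζb ηb))
    (hdiss : ∀ (n : ℕ) (x : Fin n → B) (η : Fin n → D × Db),
      0 ≤ ∑ k, ∑ l,
        (lamB (star (x l) * x k) (η l).2 (η k).2
          + lamL (star (x l) * x k) (η l).1 (η k).2
          - lamL (x k) (i (x l) (η l).1) (η k).2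
          + lamU (star (x l) * x k) (η l).2 (η k).1
          - lamU (star (x l)) (η l).2 (i (x k) (η k).1)
          + lam (star (x l) * x k) (η l).1 (η k).1
          - lam (x k) (i (x l) (η l).1) (η k).1
          - lam (star (x l)) (η l).1 (i (x k) (η k).1)
          + lam 1 (i (x l) (η l).1) (i (x k) (η k).1))) :
    ∀ (n : ℕ) (x : Fin n → B) (η : Fin n → D × Db),
      (∑ k, ∑ l, ⟪(η l).1, i (star (x l) * x k) (η k).1⟫_ℂ) = 0 →
      0 ≤ ∑ k, ∑ l,
        (lam (star (x l) * x k) (η l).1 (η k).1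
          + lamL (star (x l) * x k) (η l).1 (η k).2
          + lamU (star (x l) * x k) (η l).2 (η k).1
          + lamB (star (x l) * x k) (η l).2 (η k).2) := by
  intro n x η h
  have hS : ∑ k, i (x k) (η k).1 = 0 := by
    rw [← inner_self_eq_zero (𝕜 := ℂ), inner_sum, ← h]
    refine Finset.sum_congr rfl fun k _ => ?_
    rw [sum_inner]
    refine Finset.sum_congr rfl fun l _ => ?_
    rw [himul, LinearMap.comp_apply, ← histar (star (x l)), star_star]
  have hlamL_zero : ∑ k, ∑ l, lamL (x k) (i (x l) (η l).1) (η k).2 = 0 := by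
    simp_rw [← LinearMap.sum_apply, ← map_sum, hS, map_zero, LinearMap.zero_apply,
      Finset.sum_const_zero]
  have hlamU_zero : ∑ k, ∑ l, lamU (star (x l)) (η l).2 (i (x k) (η k).1) = 0 := by
    rw [Finset.sum_comm]
    simp_rw [← map_sum, hS, map_zero, Finset.sum_const_zero]
  have hlam_left_zero : ∑ k, ∑ l, lam (x k) (i (x l) (η l).1) (η k).1 = 0 := by
    simp_rw [← LinearMap.sum_apply, ← map_sum, hS, map_zero, LinearMap.zero_apply,
      Finset.sum_const_zero]
  have hlam_right_zero : ∑ k, ∑ l, lam (star (x l)) (η l).1 (i (x k) (η k).1) = 0 := by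
    rw [Finset.sum_comm]
    simp_rw [← map_sum, hS, map_zero, Finset.sum_const_zero]
  have hlam_one_zero : ∑ k, ∑ l, lam 1 (i (x l) (η l).1) (i (x k) (η k).1) = 0 := by
    simp_rw [← LinearMap.sum_apply, ← map_sum, hS, map_zero]
  have hpos := hdiss n x η
  simp only [Finset.sum_add_distrib, Finset.sum_sub_distrib, hlamL_zero, hlamU_zero,
    hlam_left_zero, hlam_right_zero, hlam_one_zero] at hpos ⊢
  convert hpos using 1
  ring

end
end

section
/- Theorem 2, implication (ii) ⇒ (iii), construction of the pseudo-Hilbert ♭-representation: Assume the cocycle identities (D), (C) and (A) hold. Then ȷ(1) is the identity map of E, and for all x, y ∈ B and all ξ, ξ' ∈ E one has (ȷ(y)ξ | ȷ(x)ξ') = (ξ | ȷ(y⋆ * x)ξ'); that is, ȷ is a unital ♭-representation of B on the pseudo-Hilbert space E. -/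
open scoped ComplexConjugate InnerProductSpace ComplexOrder

noncomputable section

/-- The space `𝒟'` of conjugate-linear functionals on `D`. -/
abbrev ConjDual (D : Type*) [AddCommGroup D] [Module ℂ D] :=
  D →ₛₗ[starRingEnd ℂ] ℂ

/-- The pseudo-inner product on `E = 𝒟' × 𝒟° × 𝒟` determined by a Hermitian pairing form
`Dq` on `𝒟`: `(ξ|ξ') = conj(ξ⁻(ξ'⁺)) + ξ'⁻(ξ⁺) + ⟪ξ°, ξ'°⟫ + Dq(ξ⁺, ξ'⁺)`. -/
def pseudoInner {D Dc : Type*} [NormedAddCommGroup D] [InnerProductSpace ℂ D]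
    [NormedAddCommGroup Dc] [InnerProductSpace ℂ Dc]
    (Dq : Pairing D D) (ξ ξ' : ConjDual D × Dc × D) : ℂ :=
  conj (ξ.1 ξ'.2.2) + ξ'.1 ξ.2.2 + ⟪ξ.2.1, ξ'.2.1⟫_ℂ + Dq ξ.2.2 ξ'.2.2

/-- The operator `ȷ(x) : E → E`,
`ȷ(x)(ξ⁻, ξ°, ξ⁺) = ((ζ ↦ ξ⁻(i(x⋆)ζ) + ⟪k(x⋆)ζ, ξ°⟫ + l(x)(ζ, ξ⁺)), j(x)ξ° + k(x)ξ⁺, i(x)ξ⁺)`. -/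
def germRep {B : Type*} [Monoid B] [StarMul B]
    {D Dc : Type*} [NormedAddCommGroup D] [InnerProductSpace ℂ D]
    [NormedAddCommGroup Dc] [InnerProductSpace ℂ Dc]
    (i : B → D →ₗ[ℂ] D) (j : B → Dc →ₗ[ℂ] Dc) (k : B → D →ₗ[ℂ] Dc)
    (l : B → Pairing D D) (x : B) (ξ : ConjDual D × Dc × D) : ConjDual D × Dc × D :=
  ({ toFun := fun ζ => ξ.1 (i (star x) ζ) + ⟪k (star x) ζ, ξ.2.1⟫_ℂ + l x ζ ξ.2.2
     map_add' := fun a b => by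
       simp only [map_add, LinearMap.add_apply, inner_add_left]
       ring
     map_smul' := fun c a => by
       simp only [map_smul, map_smulₛₗ, LinearMap.smul_apply, inner_smul_left,
         smul_eq_mul, RingHom.id_apply]
       ring },
   j x ξ.2.1 + k x ξ.2.2, i x ξ.2.2)

/-- Theorem 2, (ii) ⇒ (iii), construction step: under the cocycle identities (D), (C), (A),
the map `ȷ` is a unital `♭`-representation of `B` on the pseudo-Hilbert space
`E = 𝒟' × 𝒟° × 𝒟`. -/
theorem germRep_is_unital_flat_representation
    {B : Type*} [Monoid B] [StarMul B]
    {D Dc : Type*} [NormedAddCommGroup D] [InnerProductSpace ℂ D]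
    [NormedAddCommGroup Dc] [InnerProductSpace ℂ Dc]
    (i : B → D →ₗ[ℂ] D)
    (hi1 : i 1 = LinearMap.id)
    (himul : ∀ x y : B, i (x * y) = (i x).comp (i y))
    (histar : ∀ (x : B) (η ζ : D), ⟪i (star x) η, ζ⟫_ℂ = ⟪η, i x ζ⟫_ℂ)
    (j : B → Dc →ₗ[ℂ] Dc)
    (hj1 : j 1 = LinearMap.id)
    (hjmul : ∀ x y : B, j (x * y) = (j x).comp (j y))
    (hjstar : ∀ (x : B) (ξ ξ' : Dc), ⟪j (star x) ξ, ξ'⟫_ℂ = ⟪ξ, j x ξ'⟫_ℂ)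
    (k : B → D →ₗ[ℂ] Dc) (l : B → Pairing D D) (Dq : Pairing D D)
    (hDq : ∀ η ζ : D, Dq ζ η = conj (Dq η ζ))
    (hD : ∀ x y : B, k (x * y) = (j x).comp (k y) + (k x).comp (i y))
    (hC : ∀ (x y : B) (η ζ : D),
      l (x * y) η ζ = l y (i (star x) η) ζ + l x η (i y ζ) + ⟪k (star x) η, k y ζ⟫_ℂ)
    (hA : ∀ (x : B) (η ζ : D),
      conj (l x ζ η) = l (star x) η ζ + Dq η (i (star x) ζ) - Dq (i x η) ζ) :
    germRep i j k l (1 : B) = id ∧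
    ∀ (x y : B) (ξ ξ' : ConjDual D × Dc × D),
      pseudoInner Dq (germRep i j k l y ξ) (germRep i j k l x ξ')
        = pseudoInner Dq ξ (germRep i j k l (star y * x) ξ') := by
  have hk1 : k 1 = 0 := by simpa [hi1, hj1] using hD 1 1
  have hl1 (η ζ : D) : l 1 η ζ = 0 := by simpa [hi1, hk1] using hC 1 1 η ζ
  have hjadj (x : B) (a b : Dc) : ⟪j x a, b⟫_ℂ = ⟪a, j (star x) b⟫_ℂ := by
    simpa using hjstar (star x) a b
  refine ⟨funext fun ξ => ?_, fun x y ξ ξ' => ?_⟩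
  · refine Prod.ext (LinearMap.ext fun ζ => ?_) (Prod.ext ?_ ?_) <;>
      simp [germRep, hi1, hj1, hk1, hl1]
  · simp only [pseudoInner, germRep, LinearMap.coe_mk, AddHom.coe_mk, star_mul, star_star,
      himul, hjmul, hD, hC, LinearMap.comp_apply, LinearMap.add_apply, map_add, hA,
      inner_add_left, inner_add_right, inner_conj_symm, hjadj]
    ring

end
end

section
/- Theorem 2, implication (iii) ⇒ (iv): Suppose there are maps A : B → (𝒟' →ₗ[ℂ] 𝒟'), C : B → (𝒟° →ₗ[ℂ] 𝒟'), M : B → (𝒟 →ₗ[ℂ] 𝒟'), j : B → (𝒟° →ₗ[ℂ] 𝒟°) and k : B → (𝒟 →ₗ[ℂ] 𝒟°) such that the operators ȷ(x) : E → E defined by ȷ(x)(ξ⁻, ξ°, ξ⁺) := (A(x)ξ⁻ + C(x)ξ° + M(x)ξ⁺, j(x)ξ° + k(x)ξ⁺, i(x)ξ⁺) satisfy (ȷ(y)ξ | ȷ(x)ξ') = (ξ | ȷ(y⋆ * x)ξ') for all x, y ∈ B and ξ, ξ' ∈ E. Suppose L : 𝒟 × 𝒟• → E is a map whose third (⁺)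 component is L(η,η•)⁺ = η for all (η,η•), and that the germ-map satisfies Λ(x)(u,v) = (L u | ȷ(x) L v) for all x ∈ B and u, v ∈ 𝒟 × 𝒟•. Then the germ-map is conditionally positive definite with respect to i. -/
open scoped ComplexConjugate InnerProductSpace ComplexOrder

noncomputable section

/-- The pseudo-inner product distributes over finite sums in both arguments. -/
theorem pseudoInner_sum_sum {ι D Dc : Type*} [NormedAddCommGroup D] [InnerProductSpace ℂ D]
    [NormedAddCommGroup Dc] [InnerProductSpace ℂ Dc] (Dq : Pairing D D) (s : Finset ι)
    (ξ : ι → ConjDual D × Dc × D) :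
    pseudoInner Dq (∑ l ∈ s, ξ l) (∑ k ∈ s, ξ k)
      = ∑ k ∈ s, ∑ l ∈ s, pseudoInner Dq (ξ l) (ξ k) := by
  simp only [pseudoInner, Prod.fst_sum, Prod.snd_sum, map_sum, LinearMap.sum_apply,
    sum_inner, inner_sum, Finset.sum_add_distrib]
  refine congrArg₂ _ (congrArg₂ _ (congrArg₂ _ ?_ ?_) ?_) ?_ <;>
    first | rfl | exact Finset.sum_comm

/-- The pseudo-inner product is nonnegative on vectors whose `⁺`-component vanishes. -/
theorem pseudoInner_self_nonneg {D Dc : Type*} [NormedAddCommGroup D] [InnerProductSpace ℂ D]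
    [NormedAddCommGroup Dc] [InnerProductSpace ℂ Dc] (Dq : Pairing D D)
    {ξ : ConjDual D × Dc × D} (hξ : ξ.2.2 = 0) : 0 ≤ pseudoInner Dq ξ ξ := by
  simp only [pseudoInner, hξ, map_zero, zero_add, add_zero, inner_self_eq_norm_sq_to_K]
  norm_cast
  positivity

/-- Theorem 2, (iii) ⇒ (iv): a pseudo-Hilbert dilation `Λ(x)(u,v) = (L u | ȷ(x) L v)` by a
`♭`-representation `ȷ` whose `⁺`-component is `i` implies that the germ-map is conditionally
positive definite with respect to `i`. -/
theorem flat_dilation_implies_germ_cond_pos_def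
    {B : Type*} [Monoid B] [StarMul B]
    {D Db Dc : Type*} [NormedAddCommGroup D] [InnerProductSpace ℂ D]
    [NormedAddCommGroup Db] [InnerProductSpace ℂ Db]
    [NormedAddCommGroup Dc] [InnerProductSpace ℂ Dc]
    (i : B → D →ₗ[ℂ] D)
    (hi1 : i 1 = LinearMap.id)
    (himul : ∀ x y : B, i (x * y) = (i x).comp (i y))
    (histar : ∀ (x : B) (η ζ : D), ⟪i (star x) η, ζ⟫_ℂ = ⟪η, i x ζ⟫_ℂ)
    (lam : B → Pairing D D) (lamU : B → Pairing Db D)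
    (lamL : B → Pairing D Db) (lamB : B → Pairing Db Db)
    (hlam : ∀ (x : B) (η ζ : D), lam (star x) η ζ = conj (lam x ζ η))
    (hlamU : ∀ (x : B) (ηb : Db) (ζ : D), lamU (star x) ηb ζ = conj (lamL x ζ ηb))
    (hlamB : ∀ (x : B) (ηb ζb : Db), lamB (star x) ηb ζb = conj (lamB x ζb ηb))
    (Dq : Pairing D D)
    (hDq : ∀ η ζ : D, Dq ζ η = conj (Dq η ζ))
    (A : B → ConjDual D →ₗ[ℂ] ConjDual D) (C : B → Dc →ₗ[ℂ] ConjDual D)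
    (M : B → D →ₗ[ℂ] ConjDual D) (j : B → Dc →ₗ[ℂ] Dc) (k : B → D →ₗ[ℂ] Dc)
    (jmath : B → (ConjDual D × Dc × D) → (ConjDual D × Dc × D))
    (hjmath : ∀ (x : B) (ξ : ConjDual D × Dc × D),
      jmath x ξ = (A x ξ.1 + C x ξ.2.1 + M x ξ.2.2, j x ξ.2.1 + k x ξ.2.2, i x ξ.2.2))
    (hflat : ∀ (x y : B) (ξ ξ' : ConjDual D × Dc × D),
      pseudoInner Dq (jmath y ξ) (jmath x ξ') = pseudoInner Dq ξ (jmath (star y * x) ξ'))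
    (L : D × Db → ConjDual D × Dc × D)
    (hLplus : ∀ u : D × Db, (L u).2.2 = u.1)
    (hdil : ∀ (x : B) (u v : D × Db),
      lam x u.1 v.1 + lamL x u.1 v.2 + lamU x u.2 v.1 + lamB x u.2 v.2
        = pseudoInner Dq (L u) (jmath x (L v))) :
    ∀ (n : ℕ) (x : Fin n → B) (η : Fin n → D × Db),
      (∑ k, ∑ l, ⟪(η l).1, i (star (x l) * x k) (η k).1⟫_ℂ) = 0 →
      0 ≤ ∑ k, ∑ l,
        (lam (star (x l) * x k) (η l).1 (η k).1
          + lamL (star (x l) * x k) (η l).1 (η k).2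
          + lamU (star (x l) * x k) (η l).2 (η k).1
          + lamB (star (x l) * x k) (η l).2 (η k).2) := by
  intro n x η h
  have hplus : (∑ k, jmath (x k) (L (η k))).2.2 = 0 := by
    rw [← inner_self_eq_zero (𝕜 := ℂ), ← h]
    simp only [Prod.snd_sum, hjmath, hLplus, inner_sum, sum_inner]
    refine Finset.sum_congr rfl fun k _ => Finset.sum_congr rfl fun l _ => ?_
    rw [himul, LinearMap.comp_apply, ← histar (star (x l)), star_star]
  simp only [hdil, ← hflat]
  rw [← pseudoInner_sum_sum]
  exact pseudoInner_self_nonneg Dq hplus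

end
end

section
/- Sufficiency of the decomposition (3.3): Let φ : B → pairing forms of type (𝒟,𝒟), φ• : B → pairing forms of type (𝒟•,𝒟), φ_• : B → pairing forms of type (𝒟,𝒟•) and φ•• : B → pairing forms of type (𝒟•,𝒟•) be such that the matrix map Φ(x)((η,η•),(ζ,ζ•)) := φ(x)(η,ζ) + φ_•(x)(η,ζ•) + φ•(x)(η•,ζ) + φ••(x)(η•,ζ•) is positive definite: for every n, every x : Fin n → B and every η : Fin n → 𝒟 × 𝒟•, the sum ∑_{k,l} Φ((x l)⋆ * (x k))(η l, η k) is a nonnegative real number. Let K : 𝒟 → 𝒟, Kb : 𝒟 → 𝒟• and Kb' : 𝒟• → 𝒟 be linear maps with ⟪Kb η, ζ•⟫ = ⟪η, Kb' ζ•⟫ for all η ∈ 𝒟, ζ• ∈ 𝒟•. If the germ-map satisfies, for all x ∈ B and all vectors, λ(x)(η,ζ) = φ(x)(η,ζ) − ⟪Kη, i(x)ζ⟫ − ⟪η, i(x)(Kζ)⟫, λ•(x)(η•,ζ) = φ•(x)(η•,ζ) − ⟪η•, Kb(i(x)ζ)⟫, λ_•(x)(η,ζ•) = φ_•(x)(η,ζ•)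 − ⟪η, i(x)(Kb'ζ•)⟫, and λ••(x) = φ••(x), then the dissipation form of the germ-map is positive definite. -/
open scoped ComplexConjugate InnerProductSpace ComplexOrder

noncomputable section

/-- Sufficiency of the decomposition (3.3): if the germ-map differs from a positive definite
matrix map `φ` by the coboundary terms built from `K`, `Kb`, `Kb'`, then its dissipation
form is positive definite. -/
theorem decomposition_implies_dissipation_pos_def
    {B : Type*} [Monoid B] [StarMul B]
    {D Db : Type*} [NormedAddCommGroup D] [InnerProductSpace ℂ D]
    [NormedAddCommGroup Db] [InnerProductSpace ℂ Db]
    (i : B → D →ₗ[ℂ] D)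
    (hi1 : i 1 = LinearMap.id)
    (himul : ∀ x y : B, i (x * y) = (i x).comp (i y))
    (histar : ∀ (x : B) (η ζ : D), ⟪i (star x) η, ζ⟫_ℂ = ⟪η, i x ζ⟫_ℂ)
    (lam : B → Pairing D D) (lamU : B → Pairing Db D)
    (lamL : B → Pairing D Db) (lamB : B → Pairing Db Db)
    (hlam : ∀ (x : B) (η ζ : D), lam (star x) η ζ = conj (lam x ζ η))
    (hlamU : ∀ (x : B) (ηb : Db) (ζ : D), lamU (star x) ηb ζ = conj (lamL x ζ ηb))
    (hlamB : ∀ (x : B) (ηb ζb : Db), lamB (star x) ηb ζb = conj (lamB x ζb ηb))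
    (φ : B → Pairing D D) (φU : B → Pairing Db D)
    (φL : B → Pairing D Db) (φB : B → Pairing Db Db)
    (hφpos : ∀ (n : ℕ) (x : Fin n → B) (η : Fin n → D × Db),
      0 ≤ ∑ k, ∑ l,
        (φ (star (x l) * x k) (η l).1 (η k).1
          + φL (star (x l) * x k) (η l).1 (η k).2
          + φU (star (x l) * x k) (η l).2 (η k).1
          + φB (star (x l) * x k) (η l).2 (η k).2))
    (K : D →ₗ[ℂ] D) (Kb : D →ₗ[ℂ] Db) (Kb' : Db →ₗ[ℂ] D)
    (hKadj : ∀ (η : D) (ζb : Db), ⟪Kb η, ζb⟫_ℂ = ⟪η, Kb' ζb⟫_ℂ)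
    (hlam_eq : ∀ (x : B) (η ζ : D),
      lam x η ζ = φ x η ζ - ⟪K η, i x ζ⟫_ℂ - ⟪η, i x (K ζ)⟫_ℂ)
    (hlamU_eq : ∀ (x : B) (ηb : Db) (ζ : D),
      lamU x ηb ζ = φU x ηb ζ - ⟪ηb, Kb (i x ζ)⟫_ℂ)
    (hlamL_eq : ∀ (x : B) (η : D) (ζb : Db),
      lamL x η ζb = φL x η ζb - ⟪η, i x (Kb' ζb)⟫_ℂ)
    (hlamB_eq : ∀ x : B, lamB x = φB x) :
    ∀ (n : ℕ) (x : Fin n → B) (η : Fin n → D × Db),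
      0 ≤ ∑ k, ∑ l,
        (lamB (star (x l) * x k) (η l).2 (η k).2
          + lamL (star (x l) * x k) (η l).1 (η k).2
          - lamL (x k) (i (x l) (η l).1) (η k).2
          + lamU (star (x l) * x k) (η l).2 (η k).1
          - lamU (star (x l)) (η l).2 (i (x k) (η k).1)
          + lam (star (x l) * x k) (η l).1 (η k).1
          - lam (x k) (i (x l) (η l).1) (η k).1
          - lam (star (x l)) (η l).1 (i (x k) (η k).1)
          + lam 1 (i (x l) (η l).1) (i (x k) (η k).1)) := by
  intro n x η
  have star_move (a : B) (v w : D) : ⟪v, i (star a) w⟫_ℂ = ⟪i a v, w⟫_ℂ := by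
    rw [← histar, star_star]
  have hpos := hφpos (n + n) (Fin.append x fun _ => 1)
    (Fin.append η fun k => (-(i (x k) (η k).1), 0))
  simp only [Fin.sum_univ_add, Fin.append_left, Fin.append_right, ← Finset.sum_add_distrib]
    at hpos
  refine hpos.trans_eq (Finset.sum_congr rfl fun k _ => Finset.sum_congr rfl fun l _ => ?_)
  simp only [hlam_eq, hlamU_eq, hlamL_eq, hlamB_eq, himul, hi1, LinearMap.comp_apply,
    LinearMap.id_apply, star_one, one_mul, mul_one, map_neg, map_zero, LinearMap.neg_apply,
    LinearMap.zero_apply, star_move]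
  ring

end
end

section
/- Core reduction in the proof of Theorem 1 (from coherent families to the matrix form on 𝔇 ⊕ K⊗𝔇): Let 𝔇 and K be complex vector spaces and φ : B → pairing forms of type (𝔇,𝔇). Let λ : B → pairing forms of type (𝔇,𝔇), λ• : B → pairing forms of type (K ⊗[ℂ] 𝔇, 𝔇), λ_• : B → pairing forms of type (𝔇, K ⊗[ℂ] 𝔇) and λ•• : B → pairing forms of type (K ⊗[ℂ] 𝔇, K ⊗[ℂ] 𝔇). Suppose that for every n, every x : Fin n → B, a : Fin n → K and ζ : Fin n → 𝔇, the vanishing ∑_{k,l} φ((x l)⋆ * (x k))(ζ l, ζ k) = 0 implies that ∑_{k,l} [ λ••((x l)⋆ * (x k))((a l) ⊗ (ζ l), (a k) ⊗ (ζ k)) + λ•((x l)⋆ * (x k))((a l) ⊗ (ζ l), ζ k) + λ_•((x l)⋆ * (x k))(ζ l, (a k) ⊗ (ζ k)) + λ((x l)⋆ * (x k))(ζ l, ζ k) ] is a nonnegative real number. Then for every n, every x : Fin n → B, u : Fin n → 𝔇 and w : Fin n → K ⊗[ℂ] 𝔇, the vanishing ∑_{k,l} φ((x l)⋆ * (x k))(u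 l, u k) = 0 implies that ∑_{k,l} [ λ••((x l)⋆ * (x k))(w l, w k) + λ•((x l)⋆ * (x k))(w l, u k) + λ_•((x l)⋆ * (x k))(u l, w k) + λ((x l)⋆ * (x k))(u l, u k) ] is a nonnegative real number. -/
open scoped ComplexConjugate ComplexOrder TensorProduct

noncomputable section

/-- A vector `u` and a tensor `w` can be written simultaneously as `∑ ζ i` and `∑ a i ⊗ ζ i`
over the same finite family. -/
theorem exists_sum_eq_and_sum_tmul_eq {R M N : Type*} [CommRing R] [AddCommGroup M] [Module R M]
    [AddCommGroup N] [Module R N] (u : N) (w : M ⊗[R] N) :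
    ∃ (m : ℕ) (a : Fin m → M) (ζ : Fin m → N), ∑ i, ζ i = u ∧ ∑ i, a i ⊗ₜ[R] ζ i = w := by
  induction w using TensorProduct.induction_on generalizing u with
  | zero => exact ⟨1, fun _ => 0, fun _ => u, by simp, by simp⟩
  | tmul b d => exact ⟨2, ![b, 0], ![d, u - d], by simp, by simp⟩
  | add w₁ w₂ h₁ h₂ =>
    obtain ⟨m₁, a₁, ζ₁, hu₁, hw₁⟩ := h₁ u
    obtain ⟨m₂, a₂, ζ₂, hu₂, hw₂⟩ := h₂ 0
    exact ⟨m₁ + m₂, Fin.append a₁ a₂, Fin.append ζ₁ ζ₂,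
      by simp [Fin.sum_univ_add, hu₁, hu₂], by simp [Fin.sum_univ_add, hw₁, hw₂]⟩

theorem Pairing.sum_apply_sum {V W : Type*} [AddCommGroup V] [Module ℂ V] [AddCommGroup W]
    [Module ℂ W] {ι κ : Type*} [Fintype ι] [Fintype κ] (q : Pairing V W) (v : ι → V) (w : κ → W) :
    q (∑ j, v j) (∑ i, w i) = ∑ i, ∑ j, q (v j) (w i) := by
  simp only [map_sum, LinearMap.sum_apply]

theorem Fintype.sum_sigma_sum_sigma {A ι : Type*} [AddCommMonoid A] [Fintype ι] {α : ι → Type*}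
    [∀ k, Fintype (α k)] (f : (Σ k, α k) → (Σ k, α k) → A) :
    ∑ p, ∑ q, f p q = ∑ k, ∑ l, ∑ i, ∑ j, f ⟨k, i⟩ ⟨l, j⟩ := by
  simp only [Fintype.sum_sigma]
  exact Finset.sum_congr rfl fun k _ => Finset.sum_comm

/-- Core reduction in the proof of Theorem 1: conditional positivity of the matrix form on
vectors of the special shape `(ζ, a ⊗ ζ)` implies conditional positivity on all of
`𝔇 ⊕ K ⊗ 𝔇`. -/
theorem cond_pos_on_simple_vectors_implies_cond_pos
    {B : Type*} [Monoid B] [StarMul B]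
    {K Dfr : Type*} [AddCommGroup K] [Module ℂ K] [AddCommGroup Dfr] [Module ℂ Dfr]
    (φ : B → Pairing Dfr Dfr)
    (lam : B → Pairing Dfr Dfr) (lamU : B → Pairing (K ⊗[ℂ] Dfr) Dfr)
    (lamL : B → Pairing Dfr (K ⊗[ℂ] Dfr)) (lamB : B → Pairing (K ⊗[ℂ] Dfr) (K ⊗[ℂ] Dfr))
    (hsimple : ∀ (n : ℕ) (x : Fin n → B) (a : Fin n → K) (ζ : Fin n → Dfr),
      (∑ k, ∑ l, φ (star (x l) * x k) (ζ l) (ζ k)) = 0 →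
      0 ≤ ∑ k, ∑ l,
        (lamB (star (x l) * x k) ((a l) ⊗ₜ[ℂ] (ζ l)) ((a k) ⊗ₜ[ℂ] (ζ k))
          + lamU (star (x l) * x k) ((a l) ⊗ₜ[ℂ] (ζ l)) (ζ k)
          + lamL (star (x l) * x k) (ζ l) ((a k) ⊗ₜ[ℂ] (ζ k))
          + lam (star (x l) * x k) (ζ l) (ζ k))) :
    ∀ (n : ℕ) (x : Fin n → B) (u : Fin n → Dfr) (w : Fin n → K ⊗[ℂ] Dfr),
      (∑ k, ∑ l, φ (star (x l) * x k) (u l) (u k)) = 0 →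
      0 ≤ ∑ k, ∑ l,
        (lamB (star (x l) * x k) (w l) (w k)
          + lamU (star (x l) * x k) (w l) (u k)
          + lamL (star (x l) * x k) (u l) (w k)
          + lam (star (x l) * x k) (u l) (u k)) := by
  intro n x u w h
  choose m a ζ hu hw using fun k => exists_sum_eq_and_sum_tmul_eq (u k) (w k)
  let e := (Fintype.equivFin (Σ k, Fin (m k))).symm
  have key := hsimple _ (fun p => x (e p).1) (fun p => a (e p).1 (e p).2)
    (fun p => ζ (e p).1 (e p).2)
  have reindex (f : (Σ k, Fin (m k)) → (Σ k, Fin (m k)) → ℂ) :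
      ∑ p, ∑ q, f (e p) (e q) = ∑ k, ∑ l, ∑ i, ∑ j, f ⟨k, i⟩ ⟨l, j⟩ := by
    rw [← Fintype.sum_sigma_sum_sigma, ← e.sum_comp]
    exact Finset.sum_congr rfl fun p _ => e.sum_comp (f (e p))
  rw [reindex fun p q => φ (star (x q.1) * x p.1) (ζ q.1 q.2) (ζ p.1 p.2),
    reindex fun p q =>
      lamB (star (x q.1) * x p.1) (a q.1 q.2 ⊗ₜ[ℂ] ζ q.1 q.2) (a p.1 p.2 ⊗ₜ[ℂ] ζ p.1 p.2)
        + lamU (star (x q.1) * x p.1) (a q.1 q.2 ⊗ₜ[ℂ] ζ q.1 q.2) (ζ p.1 p.2)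
        + lamL (star (x q.1) * x p.1) (ζ q.1 q.2) (a p.1 p.2 ⊗ₜ[ℂ] ζ p.1 p.2)
        + lam (star (x q.1) * x p.1) (ζ q.1 q.2) (ζ p.1 p.2)] at key
  simpa only [Finset.sum_add_distrib, ← Pairing.sum_apply_sum, hu, hw] using
    key (by simpa only [← Pairing.sum_apply_sum, hu] using h)

end
end
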